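/- Let g_T be a Rota-Baxter Lie algebra and h_S a representation of g_T with action ψ. Then the vector space g ⊕ h with the semidirect product bracket [(x,h), (y,k)]_⋉ = ([x,y]_g, ψ_x(k) − ψ_y(h)) is a Lie algebra, and T ⊕ S : g ⊕ h → g ⊕ h, (x,h) ↦ (T(x), S(h)), is a Rota-Baxter operator on it. Moreover, for every compatible pair (β, α) ∈ C_ψ, the map t_{(β,α)}(x,h) = (α(x), β(h)) is a Rota-Baxter Lie algebra automorphism of (g ⋉ h)_{T⊕S} preserving h, the assignment t : C_ψ → Aut_h((g ⋉ h)_{T⊕S}), (β,α) ↦ t_{(β,α)}, is a group homomorphism, and τ∘t = id_{C_ψ}, where τ(γ) = (γ|_h, p∘γ∘s) with s and p the canonical inclusion of g and projection onto g. -/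

import Mathlib

/-- the semidirect product g ⋉ h with the operator T ⊕ S is a
Rota-Baxter Lie algebra; every compatible pair (β, α) ∈ C_ψ gives an
automorphism t_{(β,α)} preserving h, the assignment t is a group homomorphism,
and τ ∘ t = id on C_ψ. -/
theorem stmt19
    {k g h : Type*} [Field k] [CharZero k]
    [LieRing g] [LieAlgebra k g] [AddCommGroup h] [Module k h]
    (T : g →ₗ[k] g) (S : h →ₗ[k] h)
    (hT : ∀ x y : g, ⁅T x, T y⁆ = T (⁅T x, y⁆ + ⁅x, T y⁆))
    (ψ : g →ₗ[k] h →ₗ[k] h)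
    (hψmod : ∀ (x y : g) (a : h), ψ ⁅x, y⁆ a = ψ x (ψ y a) - ψ y (ψ x a))
    (hrep : ∀ (x : g) (a : h), ψ (T x) (S a) = S (ψ (T x) a + ψ x (S a))) :
    ∀ B : g × h → g × h → g × h,
      (∀ u v : g × h, B u v = (⁅u.1, v.1⁆, ψ u.1 v.2 - ψ v.1 u.2)) →
    ∀ TS : g × h → g × h, (∀ u : g × h, TS u = (T u.1, S u.2)) →
      (∀ u v w : g × h, B (u + v) w = B u w + B v w) ∧
      (∀ (c : k) (u v : g × h), B (c • u) v = c • B u v) ∧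
      (∀ u v w : g × h, B u (v + w) = B u v + B u w) ∧
      (∀ (c : k) (u v : g × h), B u (c • v) = c • B u v) ∧
      (∀ u : g × h, B u u = 0) ∧
      (∀ u v w : g × h, B (B u v) w + B (B v w) u + B (B w u) v = 0) ∧
      (∀ u v : g × h, B (TS u) (TS v) = TS (B (TS u) v + B u (TS v))) ∧
      (∀ (β : h ≃ₗ[k] h), (∀ a : h, β (S a) = S (β a)) →
        ∀ (α : g ≃ₗ[k] g), (∀ x y : g, α ⁅x, y⁆ = ⁅α x, α y⁆) →
          (∀ x : g, α (T x) = T (α x)) →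
          (∀ (x : g) (a : h), β (ψ x a) = ψ (α x) (β a)) →
          ∀ t : g × h → g × h, (∀ u : g × h, t u = (α u.1, β u.2)) →
            Function.Bijective t ∧
            (∀ u v : g × h, t (B u v) = B (t u) (t v)) ∧
            (∀ u : g × h, t (TS u) = TS (t u)) ∧
            (∀ u : g × h, u.1 = 0 → (t u).1 = 0) ∧
            (∀ (β₂ : h ≃ₗ[k] h), (∀ a : h, β₂ (S a) = S (β₂ a)) →
              ∀ (α₂ : g ≃ₗ[k] g), (∀ x y : g, α₂ ⁅x, y⁆ = ⁅α₂ x, α₂ y⁆) →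
                (∀ x : g, α₂ (T x) = T (α₂ x)) →
                (∀ (x : g) (a : h), β₂ (ψ x a) = ψ (α₂ x) (β₂ a)) →
                ∀ t₂ t₁₂ : g × h → g × h,
                  (∀ u : g × h, t₂ u = (α₂ u.1, β₂ u.2)) →
                  (∀ u : g × h, t₁₂ u = (α (α₂ u.1), β (β₂ u.2))) →
                  ∀ u : g × h, t₁₂ u = t (t₂ u)) ∧
            (∀ x : g, (t (x, (0 : h))).1 = α x) ∧
            (∀ a : h, t ((0 : g), a) = ((0 : g), β a))) := by
  intro B hB TS hTS
  refine ⟨?_, ?_, ?_, ?_, ?_, ?_, ?_, ?_⟩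
  · intro u v w
    ext
    · simp [hB]
    · simp only [hB, Prod.fst_add, Prod.snd_add, map_add, LinearMap.add_apply]
      abel
  · intro c u v
    ext <;> simp [hB, smul_sub]
  · intro u v w
    ext
    · simp [hB]
    · simp only [hB, Prod.fst_add, Prod.snd_add, map_add, LinearMap.add_apply]
      abel
  · intro c u v
    ext <;> simp [hB, smul_sub]
  · intro u
    ext <;> simp [hB]
  · intro u v w
    ext
    · simp only [hB, Prod.fst_add, Prod.fst_zero]
      rw [← lie_skew ⁅u.1, v.1⁆ w.1, ← lie_skew ⁅v.1, w.1⁆ u.1, ← lie_skew ⁅w.1, u.1⁆ v.1,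
        ← neg_add, ← neg_add, neg_eq_zero]
      rw [add_right_comm, add_comm ⁅w.1, _⁆, add_right_comm, add_right_comm, lie_jacobi]
    · simp only [hB, Prod.snd_add, Prod.snd_zero, hψmod, map_sub]
      abel
  · intro u v
    ext
    · simp [hB, hTS, hT]
    · simp only [hB, hTS, hrep, Prod.snd_add, map_add, map_sub]
      abel
  · intro β hβ α hα hαT hβα t ht
    refine ⟨⟨fun u v huv => ?_, fun v => ⟨(α.symm v.1, β.symm v.2), by simp [ht]⟩⟩,
      fun u v => by simp [hB, ht, hα, hβα], fun u => by simp [ht, hTS, hαT, hβ],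
      fun u hu => by simp [ht, hu], fun β₂ _ α₂ _ _ _ t₂ t₁₂ ht₂ ht₁₂ u => by
        simp [ht, ht₂, ht₁₂], fun x => by simp [ht], fun a => by simp [ht]⟩
    simpa [ht, Prod.ext_iff] using huv
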